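/- Hermitian semidefinite description of the trigonometric moment body: the convex hull of M_N = {(qqᵀ, qqᵀcos ω, qqᵀsin ω, ..., qqᵀcos Nω, qqᵀsin Nω) : q ∈ ℝ⁴, ‖q‖=1, ω ∈ [−π,π)} equals the set of tuples (X₀, X₁, Y₁, ..., X_N, Y_N) of 4×4 real symmetric matrices with tr(X₀) = 1 and the complex Hermitian block Toeplitz matrix Toeplitz(X₀, X₁+iY₁, ..., X_N+iY_N) positive semidefinite. -/

import Mathlib

open Matrix ComplexOrder

/-- Block Toeplitz matrix with blocks `T 0, T 1, ..., T N` (conjugate-transposed below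
the block diagonal). -/
def blockToeplitz (d N : ℕ) {R : Type*} [CommRing R] [StarRing R]
    (T : ℕ → Matrix (Fin d) (Fin d) R) :
    Matrix (Fin (N + 1) × Fin d) (Fin (N + 1) × Fin d) R :=
  fun p q =>
    if p.1.1 ≤ q.1.1 then T (q.1.1 - p.1.1) p.2 q.2 else (T (p.1.1 - q.1.1))ᴴ p.2 q.2

/-- A tuple `(X₀, X₁, Y₁, ..., X_N, Y_N)` is encoded as a pair of families
`v = (X, Y)` with `X n` and `Y n` for `n = 0, ..., N`, where `Y 0 = 0`. -/
def trigMomentSet (N : ℕ) :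
    Set ((Fin (N + 1) → Matrix (Fin 4) (Fin 4) ℝ) ×
      (Fin (N + 1) → Matrix (Fin 4) (Fin 4) ℝ)) :=
  {v | ∃ (q : Fin 4 → ℝ) (ω : ℝ), (∑ i, q i ^ 2 = 1) ∧ ω ∈ Set.Ico (-Real.pi) Real.pi ∧
    ∀ n : Fin (N + 1), v.1 n = Real.cos (n * ω) • vecMulVec q q ∧
      v.2 n = Real.sin (n * ω) • vecMulVec q q}

section unitaryDiag
open Module End
variable {H : Type*} [NormedAddCommGroup H] [InnerProductSpace ℂ H]

theorem isom_eig_norm (U : H →ₗᵢ[ℂ] H) {μ : ℂ} {v : H} (hv : U v = μ • v) (h0 : v ≠ 0) : ‖μ‖ = 1 := by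
  have h := U.norm_map v
  rw [hv, norm_smul] at h
  have : ‖v‖ ≠ 0 := norm_ne_zero_iff.2 h0
  field_simp at h
  exact h

theorem isom_orthogonalFamily (U : H →ₗᵢ[ℂ] H) :
    OrthogonalFamily ℂ (fun μ => eigenspace U.toLinearMap μ)
      fun μ => (eigenspace U.toLinearMap μ).subtypeₗᵢ := by
  rintro μ ν hμν ⟨v, hv⟩ ⟨w, hw⟩
  by_cases hv' : v = 0
  · simp [hv']
  rw [mem_eigenspace_iff] at hv hw
  simp only [LinearIsometry.coe_toLinearMap] at hv hw
  have h1 := isom_eig_norm U hv hv'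
  have h := U.inner_map_map v w
  rw [hv, hw, inner_smul_left, inner_smul_right, ← mul_assoc] at h
  have h2 : μ * (starRingEnd ℂ) μ = 1 := by
    rw [Complex.mul_conj, Complex.normSq_eq_norm_sq, h1]; simp
  change inner ℂ v w = 0
  by_contra hne
  apply hμν
  have h3 : (starRingEnd ℂ) μ * ν = 1 := by
    apply mul_right_cancel₀ hne; rw [h, one_mul]
  calc μ = μ * ((starRingEnd ℂ) μ * ν) := by rw [h3, mul_one]
    _ = ν := by rw [← mul_assoc, h2, one_mul]

theorem isom_inv (U : H →ₗᵢ[ℂ] H) (μ : ℂ) (v : H) (hv : v ∈ (eigenspace U.toLinearMap μ)ᗮ) :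
    U.toLinearMap v ∈ (eigenspace U.toLinearMap μ)ᗮ := by
  intro w hw
  have hw' := hw
  rw [mem_eigenspace_iff] at hw'
  simp only [LinearIsometry.coe_toLinearMap] at hw' ⊢
  by_cases h0 : w = 0
  · simp [h0]
  have h1 := isom_eig_norm U hw' h0
  have h := U.inner_map_map w v
  rw [hw', inner_smul_left, hv w hw] at h
  rcases mul_eq_zero.1 h with h | h
  · have : μ = 0 := by simpa using h
    simp [this] at h1
  · exact h

variable [FiniteDimensional ℂ H]

theorem isom_compl_bot (U : H →ₗᵢ[ℂ] H) : (⨆ μ, eigenspace U.toLinearMap μ)ᗮ = ⊥ := by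
  have hinv : ∀ v ∈ (⨆ μ, eigenspace U.toLinearMap μ)ᗮ,
      U.toLinearMap v ∈ (⨆ μ, eigenspace U.toLinearMap μ)ᗮ := by
    intro v hv
    rw [← Submodule.iInf_orthogonal] at hv ⊢
    exact U.toLinearMap.iInf_invariant (isom_inv U) v hv
  by_contra hne
  have : Nontrivial ↥((⨆ μ, eigenspace U.toLinearMap μ)ᗮ) := Submodule.nontrivial_iff_ne_bot.2 hne
  obtain ⟨c, hc⟩ := Module.End.exists_eigenvalue (U.toLinearMap.restrict hinv)
  obtain ⟨x, hx, hx0⟩ := hc.exists_hasEigenvector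
  rw [mem_eigenspace_iff] at hx
  have hx' : U.toLinearMap x.1 = c • x.1 := by
    simpa using congrArg Subtype.val hx
  have hm : x.1 ∈ ⨆ μ, eigenspace U.toLinearMap μ :=
    (le_iSup (fun μ => eigenspace U.toLinearMap μ) c) (mem_eigenspace_iff.2 hx')
  apply hx0
  have := x.2 x.1 hm
  exact Subtype.ext (inner_self_eq_zero.1 this)

theorem isom_diag (U : H →ₗᵢ[ℂ] H) : ∃ (n : ℕ) (b : OrthonormalBasis (Fin n) ℂ H) (ω : Fin n → ℝ),
    (∀ k, ω k ∈ Set.Ico (-Real.pi) Real.pi) ∧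
    ∀ k, U (b k) = Complex.exp (ω k * Complex.I) • b k := by
  classical
  have hfam : OrthogonalFamily ℂ (fun μ : Eigenvalues U.toLinearMap => eigenspace U.toLinearMap μ) fun μ =>
      (eigenspace U.toLinearMap μ).subtypeₗᵢ :=
    (isom_orthogonalFamily U).comp Subtype.coe_injective
  have hint : DirectSum.IsInternal (fun μ : Eigenvalues U.toLinearMap => eigenspace U.toLinearMap μ) := by
    rw [hfam.isInternal_iff]
    change (⨆ μ : { μ // eigenspace U.toLinearMap μ ≠ ⊥ }, eigenspace U.toLinearMap μ)ᗮ = ⊥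
    rw [iSup_ne_bot_subtype, isom_compl_bot]
  let b := hint.subordinateOrthonormalBasis rfl hfam
  have hb : ∀ k, ∃ μ : ℂ, U (b k) = μ • b k := fun k =>
    ⟨_, mem_eigenspace_iff.1 (hint.subordinateOrthonormalBasis_subordinate rfl k hfam)⟩
  have hb2 : ∀ k, ∃ ω : ℝ, ω ∈ Set.Ico (-Real.pi) Real.pi ∧
      U (b k) = Complex.exp (ω * Complex.I) • b k := by
    intro k
    obtain ⟨μ, h⟩ := hb k
    have h1 := isom_eig_norm U h (b.orthonormal.ne_zero k)
    have h2 : Complex.exp (Complex.arg μ * Complex.I) = μ := by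
      have := Complex.norm_mul_exp_arg_mul_I μ
      rwa [h1, Complex.ofReal_one, one_mul] at this
    rcases (Complex.arg_le_pi μ).lt_or_eq with h3 | h3
    · exact ⟨_, ⟨(Complex.neg_pi_lt_arg μ).le, h3⟩, by rw [h2, h]⟩
    · refine ⟨-Real.pi, ⟨le_rfl, by linarith [Real.pi_pos]⟩, ?_⟩
      rw [h, ← h2, h3]
      congr 1
      rw [Complex.exp_pi_mul_I]
      push_cast
      rw [neg_mul, Complex.exp_neg, Complex.exp_pi_mul_I]; norm_num
  choose ω h1 h2 using hb2
  exact ⟨_, b, ω, h1, h2⟩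

end unitaryDiag

/-- Two finite families with equal Gram matrices are related by an isometry. -/
theorem exists_isom {H ι : Type*} [NormedAddCommGroup H] [InnerProductSpace ℂ H]
    [FiniteDimensional ℂ H] [Fintype ι] (x y : ι → H)
    (h : ∀ i j, inner ℂ (x i) (x j) = inner ℂ (y i) (y j)) :
    ∃ U : H →ₗᵢ[ℂ] H, ∀ i, U (x i) = y i := by
  classical
  let A := Fintype.linearCombination ℂ x
  let B := Fintype.linearCombination ℂ y
  have hn : ∀ c, ‖A c‖ = ‖B c‖ := by
    intro c
    have : inner ℂ (A c) (A c) = inner ℂ (B c) (B c) := by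
      simp only [A, B, Fintype.linearCombination_apply, sum_inner, inner_sum, inner_smul_left,
        inner_smul_right, h]
    rw [inner_self_eq_norm_sq_to_K, inner_self_eq_norm_sq_to_K] at this
    have h2 : ‖A c‖ ^ 2 = ‖B c‖ ^ 2 := by exact_mod_cast this
    exact (sq_eq_sq₀ (norm_nonneg _) (norm_nonneg _)).1 h2
  obtain ⟨s, hs⟩ := A.rangeRestrict.exists_rightInverse_of_surjective A.range_rangeRestrict
  have hs' : ∀ z, A (s z) = z.1 := fun z => congrArg Subtype.val (LinearMap.congr_fun hs z)
  let L : LinearMap.range A →ₗᵢ[ℂ] H := ⟨B ∘ₗ s, fun z => by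
    change ‖B (s z)‖ = ‖z.1‖
    rw [← hn, hs']⟩
  refine ⟨L.extend, fun i => ?_⟩
  have hx : A (Pi.single i 1) = x i := by simp [A]
  have hy : B (Pi.single i 1) = y i := by simp [B]
  have := L.extend_apply ⟨x i, ⟨_, hx⟩⟩
  rw [← hy]
  refine this.trans ?_
  change B (s _) = _
  rw [← sub_eq_zero, ← map_sub, ← norm_eq_zero, ← hn, map_sub, hs', hx]
  simp

theorem toeplitz_decomp (d N : ℕ) (T : ℕ → Matrix (Fin d) (Fin d) ℂ)
    (hP : (blockToeplitz d N T).PosSemidef) :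
    ∃ (m : ℕ) (c : Fin m → Fin d → ℂ) (ω : Fin m → ℝ),
      (∀ k, ω k ∈ Set.Ico (-Real.pi) Real.pi) ∧
      ∀ n ≤ N, ∀ a b, T n a b =
        ∑ k, Complex.exp (ω k * Complex.I) ^ n * (star (c k a) * c k b) := by
  classical
  obtain ⟨B, hB⟩ : ∃ B : Matrix (Fin (N + 1) × Fin d) (Fin (N + 1) × Fin d) ℂ,
      blockToeplitz d N T = Bᴴ * B := by
    open scoped MatrixOrder in
    exact CStarAlgebra.nonneg_iff_eq_star_mul_self.mp hP.nonneg
  let v : Fin (N + 1) × Fin d → EuclideanSpace ℂ (Fin (N + 1) × Fin d) :=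
    fun p => WithLp.toLp 2 (fun r => B r p)
  have hv : ∀ p q, inner ℂ (v p) (v q) = blockToeplitz d N T p q := by
    intro p q
    rw [hB]
    simp [v, Matrix.mul_apply, PiLp.inner_apply, mul_comm]
  obtain ⟨U, hU⟩ := exists_isom (fun p : Fin N × Fin d => v (p.1.castSucc, p.2))
    (fun p : Fin N × Fin d => v (p.1.succ, p.2)) (by
      rintro ⟨j, a⟩ ⟨k, b⟩
      simp [hv, blockToeplitz])
  obtain ⟨m, e, ω, hω, he⟩ := isom_diag U
  refine ⟨m, fun k a => inner ℂ (e k) (v (0, a)), ω, hω, fun n hn a b => ?_⟩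
  have key : ∀ n (hn : n ≤ N), v (⟨n, Nat.lt_succ_of_le hn⟩, b) =
      ∑ k, (Complex.exp (ω k * Complex.I) ^ n * inner ℂ (e k) (v (0, b))) • e k := by
    intro n
    induction n with
    | zero =>
      intro hn
      simpa using (e.sum_repr' (v (0, b))).symm
    | succ n ih =>
      intro hn
      have h1 := hU (⟨n, hn⟩, b)
      have h2 := ih (by omega)
      simp only [Fin.castSucc_mk, Fin.succ_mk] at h1
      rw [← h1, h2, map_sum]
      refine Finset.sum_congr rfl fun k _ => ?_
      rw [map_smul, he, smul_smul]
      congr 1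
      ring
  have h0 : T n a b = inner ℂ (v (0, a)) (v (⟨n, Nat.lt_succ_of_le hn⟩, b)) := by
    rw [hv]; simp [blockToeplitz]
  rw [h0, key n hn, inner_sum]
  refine Finset.sum_congr rfl fun k _ => ?_
  rw [inner_smul_right, ← inner_conj_symm (v (0, a)) (e k)]
  simp only [RCLike.star_def]
  ring

theorem exists_unit (x : Fin 4 → ℝ) : ∃ q : Fin 4 → ℝ, (∑ i, q i ^ 2 = 1) ∧
    vecMulVec x x = (∑ i, x i ^ 2) • vecMulVec q q := by
  by_cases h : ∑ i, x i ^ 2 = 0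
  · refine ⟨Pi.single 0 1, by simp [Fin.sum_univ_four], ?_⟩
    rw [h, zero_smul]
    rw [Finset.sum_eq_zero_iff_of_nonneg (fun i _ => sq_nonneg _)] at h
    ext i j
    have := h i (Finset.mem_univ _)
    simp_all [vecMulVec_apply]
  · have hp : 0 ≤ ∑ i, x i ^ 2 := Finset.sum_nonneg fun i _ => sq_nonneg _
    have hs := Real.sq_sqrt hp
    have hs0 : Real.sqrt (∑ i, x i ^ 2) ≠ 0 := by
      intro h0; rw [h0] at hs; apply h; rw [← hs]; norm_num
    refine ⟨fun i => x i / Real.sqrt (∑ i, x i ^ 2), ?_, ?_⟩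
    · simp only [div_pow, hs]
      rw [← Finset.sum_div, div_self h]
    · ext i j
      simp only [vecMulVec_apply, Matrix.smul_apply, smul_eq_mul]
      rw [div_mul_div_comm, Real.mul_self_sqrt hp]
      field_simp


/-- Hermitian semidefinite description of the trigonometric moment body
(Lemma 1 of the paper): `conv(M_N)` equals the set of tuples of real symmetric
matrices with `tr X₀ = 1` and `Toeplitz(X₀, X₁+iY₁, ..., X_N+iY_N) ⪰ 0`. -/
theorem convexHull_trigMomentSet_hermitian (N : ℕ) :
    convexHull ℝ (trigMomentSet N) =
      {v : (Fin (N + 1) → Matrix (Fin 4) (Fin 4) ℝ) ×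
          (Fin (N + 1) → Matrix (Fin 4) (Fin 4) ℝ) |
        (∀ n, (v.1 n).IsSymm ∧ (v.2 n).IsSymm) ∧ v.2 0 = 0 ∧ (v.1 0).trace = 1 ∧
        (blockToeplitz 4 N (fun n =>
            if h : n ≤ N then
              (v.1 ⟨n, Nat.lt_succ_of_le h⟩).map (fun a => (a : ℂ)) +
                Complex.I • (v.2 ⟨n, Nat.lt_succ_of_le h⟩).map (fun a => (a : ℂ))
            else 0)).PosSemidef} := by
  apply Set.Subset.antisymm
  · apply convexHull_min
    · rintro ⟨X, Y⟩ ⟨q, ω, hq, -, h⟩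
      simp only at h
      have hsym : (vecMulVec q q).IsSymm := by
        ext i j; simp [vecMulVec_apply, mul_comm]
      refine ⟨fun n => ?_, ?_, ?_, ?_⟩
      · simp only [(h n).1, (h n).2]
        exact ⟨hsym.smul _, hsym.smul _⟩
      · simp [(h 0).2]
      · have hq' : ∑ i, q i * q i = 1 := by simpa only [sq] using hq
        simp [(h 0).1, Matrix.trace, vecMulVec_apply, hq']
      · have := posSemidef_vecMulVec_star_self
          (fun p : Fin (N + 1) × Fin 4 => Complex.exp (ω * Complex.I) ^ p.1.1 * (q p.2 : ℂ))
        convert this using 1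
        have hz : ∀ n : ℕ, (Real.cos (n * ω) : ℂ) + Complex.I * Real.sin (n * ω) =
            Complex.exp (ω * Complex.I) ^ n := by
          intro n
          rw [← Complex.exp_nat_mul, ← mul_assoc, Complex.exp_mul_I]
          push_cast; ring
        have hc : ∀ n : ℕ, (starRingEnd ℂ) (Complex.exp (ω * Complex.I)) ^ n *
            Complex.exp (ω * Complex.I) ^ n = 1 := by
          intro n
          rw [← mul_pow, ← Complex.exp_conj, ← Complex.exp_add]; simp
        have hT : ∀ n, n ≤ N → ∀ a b,
            (if h : n ≤ N then
              (X ⟨n, Nat.lt_succ_of_le h⟩).map (fun a => (a : ℂ)) +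
                Complex.I • (Y ⟨n, Nat.lt_succ_of_le h⟩).map (fun a => (a : ℂ))
            else 0) a b = Complex.exp (ω * Complex.I) ^ n * (q a * q b) := by
          intro n hn a b
          rw [dif_pos hn, (h _).1, (h _).2, ← hz]
          simp [vecMulVec_apply]
          ring
        ext ⟨⟨j, hj⟩, a⟩ ⟨⟨k, hk⟩, b⟩
        simp only [blockToeplitz, vecMulVec_apply, Pi.star_apply, RCLike.star_def, map_mul,
          map_pow, Complex.conj_ofReal]
        by_cases hjk : j ≤ k
        · rw [if_pos hjk, hT _ (by omega)]
          obtain ⟨l, rfl⟩ := Nat.exists_eq_add_of_le hjk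
          rw [Nat.add_sub_cancel_left, pow_add]
          linear_combination (-(Complex.exp (ω * Complex.I)) ^ l * q a * q b) * hc j
        · rw [if_neg hjk, conjTranspose_apply, hT _ (by omega)]
          obtain ⟨l, rfl⟩ := Nat.exists_eq_add_of_le (not_le.1 hjk).le
          simp only [RCLike.star_def, map_mul, map_pow, Complex.conj_ofReal]
          rw [Nat.add_sub_cancel_left, pow_add]
          linear_combination
            (-((starRingEnd ℂ) (Complex.exp (ω * Complex.I))) ^ l * q a * q b) * hc k
    · rintro ⟨X, Y⟩ ⟨h1, h2, h3, h4⟩ ⟨X', Y'⟩ ⟨h1', h2', h3', h4'⟩ s t hs ht hst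
      simp only at h1 h2 h3 h4 h1' h2' h3' h4'
      refine ⟨fun n => ⟨?_, ?_⟩, ?_, ?_, ?_⟩
      · exact ((h1 n).1.smul s).add ((h1' n).1.smul t)
      · exact ((h1 n).2.smul s).add ((h1' n).2.smul t)
      · simp [h2, h2']
      · simp [h3, h3', hst]
      · have hs' : (0 : ℂ) ≤ s := by exact_mod_cast hs
        have ht' : (0 : ℂ) ≤ t := by exact_mod_cast ht
        convert (h4.smul hs').add (h4'.smul ht') using 1
        ext ⟨⟨j, hj⟩, a⟩ ⟨⟨k, hk⟩, b⟩
        have e1 : k - j ≤ N := by omega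
        have e2 : j - k ≤ N := by omega
        simp only [blockToeplitz, Matrix.add_apply, Matrix.smul_apply, e1, e2, dif_pos]
        split_ifs with hjk
        · simp; ring
        · simp; ring
  · rintro ⟨X, Y⟩ ⟨h1, h2, h3, h4⟩
    simp only at h1 h2 h3 h4
    obtain ⟨m, c, ω, hω, hd⟩ := toeplitz_decomp 4 N _ h4
    let z : Fin m × Bool → Fin 4 → ℝ := fun p i => if p.2 then (c p.1 i).re else (c p.1 i).im
    have hz : ∀ n : Fin (N + 1), ∀ a b,
        ((X n a b : ℝ) : ℂ) + Complex.I * (Y n a b : ℝ) =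
          ∑ k, Complex.exp (ω k * Complex.I) ^ n.1 *
            ((z (k, true) a * z (k, true) b + z (k, false) a * z (k, false) b : ℝ) : ℂ) := by
      intro n a b
      have hn : n.1 ≤ N := Nat.le_of_lt_succ n.2
      have ea := hd n hn a b
      have eb := hd n hn b a
      simp only [dif_pos hn, Matrix.add_apply, Matrix.smul_apply, Matrix.map_apply,
        smul_eq_mul, Fin.eta] at ea eb
      rw [(h1 n).1.apply, (h1 n).2.apply] at eb
      have e2 : ((X n a b : ℝ) : ℂ) + Complex.I * (Y n a b : ℝ) =
        (1 / 2) * ((∑ k, Complex.exp (ω k * Complex.I) ^ n.1 * (star (c k a) * c k b)) +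
          ∑ k, Complex.exp (ω k * Complex.I) ^ n.1 * (star (c k b) * c k a)) := by
        rw [← ea, ← eb]; ring
      rw [e2, ← Finset.sum_add_distrib, Finset.mul_sum]
      refine Finset.sum_congr rfl fun k _ => ?_
      have : star (c k a) * c k b + star (c k b) * c k a =
          2 * ((z (k, true) a * z (k, true) b + z (k, false) a * z (k, false) b : ℝ) : ℂ) := by
        apply Complex.ext
        · simp [z]; ring
        · simp [z]; ring
      linear_combination (1 / 2) * Complex.exp (ω k * Complex.I) ^ n.1 * this
    have hexp : ∀ (k : Fin m) (n : ℕ), Complex.exp (ω k * Complex.I) ^ n =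
        (Real.cos (n * ω k) : ℂ) + Real.sin (n * ω k) * Complex.I := by
      intro k n
      rw [← Complex.exp_nat_mul, ← mul_assoc, Complex.exp_mul_I]
      push_cast; ring
    have hX : ∀ n : Fin (N + 1), X n =
        ∑ p : Fin m × Bool, Real.cos (n.1 * ω p.1) • vecMulVec (z p) (z p) := by
      intro n
      ext a b
      have := congrArg Complex.re (hz n a b)
      simp only [hexp] at this
      rw [Complex.re_sum] at this
      simp only [Complex.add_re, Complex.mul_re, Complex.ofReal_re, Complex.ofReal_im,
        Complex.I_re, Complex.I_im, Complex.add_im, Complex.mul_im] at this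
      rw [Matrix.sum_apply, Fintype.sum_prod_type]
      simp only [Fintype.sum_bool, Matrix.smul_apply, vecMulVec_apply, smul_eq_mul]
      convert this using 1
      · ring
      · exact Finset.sum_congr rfl fun k _ => by ring
    have hY : ∀ n : Fin (N + 1), Y n =
        ∑ p : Fin m × Bool, Real.sin (n.1 * ω p.1) • vecMulVec (z p) (z p) := by
      intro n
      ext a b
      have := congrArg Complex.im (hz n a b)
      simp only [hexp] at this
      rw [Complex.im_sum] at this
      simp only [Complex.add_re, Complex.mul_re, Complex.ofReal_re, Complex.ofReal_im,
        Complex.I_re, Complex.I_im, Complex.add_im, Complex.mul_im] at this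
      rw [Matrix.sum_apply, Fintype.sum_prod_type]
      simp only [Fintype.sum_bool, Matrix.smul_apply, vecMulVec_apply, smul_eq_mul]
      convert this using 1
      · ring
      · exact Finset.sum_congr rfl fun k _ => by ring
    choose q hq hzq using fun p => exists_unit (z p)
    have hsum : ∑ p, ∑ i, z p i ^ 2 = 1 := by
      rw [← h3, hX 0, Matrix.trace_sum]
      refine Finset.sum_congr rfl fun p _ => ?_
      simp [Matrix.trace, vecMulVec_apply, sq]
    let P : Fin m × Bool → (Fin (N + 1) → Matrix (Fin 4) (Fin 4) ℝ) ×
        (Fin (N + 1) → Matrix (Fin 4) (Fin 4) ℝ) := fun p =>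
      ((fun n => Real.cos ((n.1 : ℝ) * ω p.1) • vecMulVec (q p) (q p)),
        (fun n => Real.sin ((n.1 : ℝ) * ω p.1) • vecMulVec (q p) (q p)))
    have hP : ∀ p, P p ∈ convexHull ℝ (trigMomentSet N) := fun p =>
      subset_convexHull ℝ _ ⟨q p, ω p.1, hq p, hω p.1, fun n => ⟨rfl, rfl⟩⟩
    have hw : ∀ p : Fin m × Bool, 0 ≤ ∑ i, z p i ^ 2 :=
      fun p => Finset.sum_nonneg fun i _ => sq_nonneg _
    have hmem : ∑ p, (∑ i, z p i ^ 2) • P p ∈ convexHull ℝ (trigMomentSet N) :=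
      (convex_convexHull ℝ (trigMomentSet N)).sum_mem (fun p _ => hw p) hsum (fun p _ => hP p)
    convert hmem using 1
    refine Prod.ext ?_ ?_
    · rw [Prod.fst_sum]
      funext n
      rw [Finset.sum_apply]
      refine (hX n).trans ?_
      refine Finset.sum_congr rfl fun p _ => ?_
      rw [hzq p, smul_comm]
      rfl
    · rw [Prod.snd_sum]
      funext n
      rw [Finset.sum_apply]
      refine (hY n).trans ?_
      refine Finset.sum_congr rfl fun p _ => ?_
      rw [hzq p, smul_comm]
      rfl
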